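/- Let k and n be positive integers, let μ ∈ ℝ^k, let R be a real symmetric positive definite k×k matrix, and let y be a random vector in ℝ^k with the multivariate Gaussian distribution N(μ, R). Then for every σ > 0 and every z_1, …, z_n ∈ ℝ^k, setting z̄ = (1/n) Σ_{j=1}^n z_j, the matrix (σ²/n)I + R is invertible and E[ Π_{j=1}^n exp( −‖y − z_j‖² / (2σ²) ) ] = exp( −( Σ_{j=1}^n ‖z_j − z̄‖² ) / (2σ²) ) · det( I + n σ⁻² R )^{−1/2} · exp( −½ (z̄ − μ)ᵀ ( (σ²/n) I + R )⁻¹ (z̄ − μ) ). -/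

import Mathlib

open MeasureTheory Matrix

open scoped MatrixOrder in
/-- A real positive definite matrix is a Gram matrix. -/
theorem Matrix.PosDef.exists_eq_transpose_mul_self {ι : Type*} [Fintype ι] [DecidableEq ι]
    {A : Matrix ι ι ℝ} (hA : A.PosDef) : ∃ B : Matrix ι ι ℝ, A = Bᵀ * B := by
  obtain ⟨B, hB⟩ := CStarAlgebra.nonneg_iff_eq_star_mul_self.mp hA.posSemidef.nonneg
  exact ⟨B, by simpa [star_eq_conjTranspose] using hB⟩

theorem integral_exp_neg_half_dotProduct_self (ι : Type*) [Fintype ι] :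
    ∫ y : ι → ℝ, Real.exp (-(1/2) * (y ⬝ᵥ y)) = √(2 * Real.pi) ^ Fintype.card ι := by
  have h (y : ι → ℝ) :
      Real.exp (-(1/2) * (y ⬝ᵥ y)) = ∏ i, Real.exp (-(1/2) * y i ^ 2) := by
    rw [← Real.exp_sum, ← Finset.mul_sum]
    simp [dotProduct, sq]
  simp_rw [h]
  rw [integral_fintype_prod_volume_eq_pow (fun x : ℝ => Real.exp (-(1/2) * x ^ 2)),
    integral_gaussian]
  congr 2
  ring

theorem integral_comp_mulVec {ι : Type*} [Fintype ι] [DecidableEq ι] {B : Matrix ι ι ℝ}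
    (hB : B.det ≠ 0) {f : (ι → ℝ) → ℝ} (hf : Continuous f) :
    ∫ y, f (B *ᵥ y) = |B.det|⁻¹ * ∫ y, f y := by
  have hmeas : Measurable (Matrix.toLin' B) :=
    (LinearMap.continuous_of_finiteDimensional _).measurable
  have h := integral_map (μ := volume) hmeas.aemeasurable
    (hf.aestronglyMeasurable (μ := Measure.map (Matrix.toLin' B) volume))
  rw [Real.map_matrix_volume_pi_eq_smul_volume_pi hB, integral_smul_measure] at h
  simpa [abs_inv] using h.symm

/-- The Gaussian integral for a positive definite quadratic form. -/
theorem Matrix.PosDef.integral_exp_neg_half_dotProduct_mulVec {ι : Type*} [Fintype ι]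
    [DecidableEq ι] {A : Matrix ι ι ℝ} (hA : A.PosDef) (c : ι → ℝ) :
    ∫ y : ι → ℝ, Real.exp (-(1/2) * ((y - c) ⬝ᵥ (A *ᵥ (y - c)))) =
      √(2 * Real.pi) ^ Fintype.card ι * (√A.det)⁻¹ := by
  rw [integral_sub_right_eq_self (fun y : ι → ℝ => Real.exp (-(1/2) * (y ⬝ᵥ (A *ᵥ y)))) c]
  have hdet := hA.det_pos
  obtain ⟨B, rfl⟩ := hA.exists_eq_transpose_mul_self
  rw [det_mul, det_transpose] at hdet ⊢
  have hB : B.det ≠ 0 := fun h => by simp [h] at hdet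
  have h (y : ι → ℝ) : y ⬝ᵥ ((Bᵀ * B) *ᵥ y) = (B *ᵥ y) ⬝ᵥ (B *ᵥ y) := by
    rw [← mulVec_mulVec, dotProduct_mulVec, vecMul_transpose]
  simp_rw [h]
  rw [integral_comp_mulVec hB (f := fun y => Real.exp (-(1/2) * (y ⬝ᵥ y))) (by fun_prop),
    integral_exp_neg_half_dotProduct_self, Real.sqrt_mul_self_eq_abs, mul_comm]

/-- The squared distances to a family of points split around its mean. -/
theorem sum_dotProduct_sub_self {ι κ : Type*} [Fintype ι] [Fintype κ] [Nonempty κ]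
    (z : κ → ι → ℝ) {m : ι → ℝ} (hm : m = (Fintype.card κ : ℝ)⁻¹ • ∑ j, z j) (y : ι → ℝ) :
    ∑ j, (y - z j) ⬝ᵥ (y - z j) =
      Fintype.card κ * ((y - m) ⬝ᵥ (y - m)) + ∑ j, (z j - m) ⬝ᵥ (z j - m) := by
  have hsum : ∑ j, (z j - m) = 0 := by
    rw [Finset.sum_sub_distrib, Finset.sum_const, Finset.card_univ, hm, ← Nat.cast_smul_eq_nsmul ℝ,
      smul_inv_smul₀ (by simp), sub_self]
  have h (j : κ) : (y - z j) ⬝ᵥ (y - z j) =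
      (y - m) ⬝ᵥ (y - m) - 2 * ((y - m) ⬝ᵥ (z j - m)) + (z j - m) ⬝ᵥ (z j - m) := by
    rw [← sub_sub_sub_cancel_right y (z j) m]
    generalize y - m = u, z j - m = v
    rw [sub_dotProduct, dotProduct_sub, dotProduct_sub, dotProduct_comm v u]
    ring
  simp_rw [h]
  rw [Finset.sum_add_distrib, Finset.sum_sub_distrib, ← Finset.mul_sum,
    ← dotProduct_sum (y - m) Finset.univ (fun j => z j - m), hsum]
  simp only [dotProduct_zero, mul_zero, sub_zero, Finset.sum_const, Finset.card_univ,
    nsmul_eq_mul]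

/-- Completing the square in a sum of two positive definite quadratic forms, one isotropic. -/
theorem Matrix.PosDef.completing_square {ι : Type*} [Fintype ι] [DecidableEq ι]
    {R : Matrix ι ι ℝ} (hR : R.PosDef) {a : ℝ} (ha : 0 < a) (u d : ι → ℝ) :
    a * ((u - d) ⬝ᵥ (u - d)) + u ⬝ᵥ (R⁻¹ *ᵥ u) =
      (u - R *ᵥ ((a⁻¹ • 1 + R)⁻¹ *ᵥ d)) ⬝ᵥ
          ((R⁻¹ + a • 1) *ᵥ (u - R *ᵥ ((a⁻¹ • 1 + R)⁻¹ *ᵥ d))) +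
        d ⬝ᵥ ((a⁻¹ • 1 + R)⁻¹ *ᵥ d) := by
  have hS : IsUnit (a⁻¹ • 1 + R).det :=
    (isUnit_iff_isUnit_det _).mp ((PosDef.one.smul (inv_pos.mpr ha)).add hR).isUnit
  have hRu : IsUnit R.det := (isUnit_iff_isUnit_det _).mp hR.isUnit
  set v := (a⁻¹ • 1 + R)⁻¹ *ᵥ d with hv
  have hd : d = a⁻¹ • v + R *ᵥ v := by
    have : (a⁻¹ • 1 + R) *ᵥ v = d := by rw [hv, mulVec_mulVec, mul_nonsing_inv _ hS, one_mulVec]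
    rw [← this, add_mulVec, smul_mulVec, one_mulVec]
  have hRR : R⁻¹ *ᵥ (R *ᵥ v) = v := by rw [mulVec_mulVec, nonsing_inv_mul _ hRu, one_mulVec]
  have hRT : (R⁻¹)ᵀ = R⁻¹ := by simpa using hR.inv.isHermitian.eq
  have hsymm : (R *ᵥ v) ⬝ᵥ (R⁻¹ *ᵥ u) = u ⬝ᵥ v := by
    rw [dotProduct_mulVec, ← mulVec_transpose, hRT, hRR, dotProduct_comm]
  clear_value v
  subst hd
  simp only [add_mulVec, mulVec_sub, smul_mulVec, one_mulVec, hRR, sub_dotProduct, dotProduct_sub,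
    dotProduct_add, add_dotProduct, dotProduct_smul, smul_dotProduct, smul_eq_mul, hsymm,
    dotProduct_comm (R *ᵥ v) u, dotProduct_comm v u, dotProduct_comm (R *ᵥ v) v]
  field_simp
  ring

/-- Gaussian-kernel `n`-fold product moment: for `y ~ N(μ, R)` (encoded by its density
with respect to Lebesgue measure) and points `z_1, …, z_n` with mean `z̄`, the matrix
`(σ²/n)I + R` is invertible and
`E[∏ⱼ exp(-‖y-zⱼ‖²/(2σ²))] = exp(-Σⱼ‖zⱼ-z̄‖²/(2σ²)) det(I + nσ⁻²R)^{-1/2}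
  exp(-½ (z̄-μ)ᵀ((σ²/n)I + R)⁻¹(z̄-μ))`. -/
theorem stmt_19 {k n : ℕ} (hk : 0 < k) (hn : 0 < n)
    (μ : Fin k → ℝ) (R : Matrix (Fin k) (Fin k) ℝ) (hR : R.PosDef)
    (P : Measure (Fin k → ℝ))
    (hP : P = volume.withDensity (fun y => ENNReal.ofReal
      (((2 * Real.pi) ^ (k : ℝ) * R.det) ^ (-(1/2 : ℝ))
        * Real.exp (-(1/2) * ((y - μ) ⬝ᵥ (R⁻¹ *ᵥ (y - μ))))))) :
    ∀ (σ : ℝ), 0 < σ → ∀ z : Fin n → Fin k → ℝ, ∀ zbar : Fin k → ℝ,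
      zbar = (n : ℝ)⁻¹ • ∑ j, z j →
      IsUnit ((σ^2/(n : ℝ)) • (1 : Matrix (Fin k) (Fin k) ℝ) + R) ∧
      ∫ y, (∏ j, Real.exp (-((y - z j) ⬝ᵥ (y - z j)) / (2 * σ^2))) ∂P
        = Real.exp (-(∑ j, (z j - zbar) ⬝ᵥ (z j - zbar)) / (2 * σ^2))
          * ((1 : Matrix (Fin k) (Fin k) ℝ) + ((n : ℝ) * (σ^2)⁻¹) • R).det ^ (-(1/2 : ℝ))
          * Real.exp (-(1/2) * ((zbar - μ) ⬝ᵥ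
              (((σ^2/(n : ℝ)) • (1 : Matrix (Fin k) (Fin k) ℝ) + R)⁻¹ *ᵥ (zbar - μ)))) := by
  intro σ hσ z zbar hz
  have hn' : (0 : ℝ) < n := by exact_mod_cast hn
  have : Nonempty (Fin n) := ⟨⟨0, hn⟩⟩
  obtain ⟨a, ha⟩ : ∃ a : ℝ, a = n * (σ^2)⁻¹ := ⟨_, rfl⟩
  have ha0 : 0 < a := ha ▸ by positivity
  have hainv : σ^2 / (n : ℝ) = a⁻¹ := by rw [ha]; field_simp
  rw [hainv, ← ha]
  refine ⟨((PosDef.one.smul (inv_pos.mpr ha0)).add hR).isUnit, ?_⟩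
  have hdens : Measurable fun y : Fin k → ℝ => ENNReal.ofReal
      (((2 * Real.pi) ^ (k : ℝ) * R.det) ^ (-(1/2 : ℝ))
        * Real.exp (-(1/2) * ((y - μ) ⬝ᵥ (R⁻¹ *ᵥ (y - μ))))) := by
    have : Continuous fun y : Fin k → ℝ => (y - μ) ⬝ᵥ (R⁻¹ *ᵥ (y - μ)) := by fun_prop
    exact (by fun_prop : Continuous _).measurable.ennreal_ofReal
  have hRdet := hR.det_pos
  set S := a⁻¹ • (1 : Matrix (Fin k) (Fin k) ℝ) + R with hS
  set C := ((2 * Real.pi) ^ (k : ℝ) * R.det) ^ (-(1/2 : ℝ)) with hC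
  have hC0 : 0 ≤ C := by positivity
  have hA : (R⁻¹ + a • 1).PosDef := hR.inv.add (PosDef.one.smul ha0)
  have hdet : (1 + a • R).det = R.det * (R⁻¹ + a • 1).det := by
    rw [← det_mul, mul_add, mul_nonsing_inv _ ((isUnit_iff_isUnit_det _).mp hR.isUnit),
      mul_smul_comm, mul_one]
  have hint (y : Fin k → ℝ) :
      (ENNReal.ofReal (C * Real.exp (-(1/2) * ((y - μ) ⬝ᵥ (R⁻¹ *ᵥ (y - μ)))))).toReal •
        ∏ j, Real.exp (-((y - z j) ⬝ᵥ (y - z j)) / (2 * σ^2)) =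
      (C * Real.exp (-(∑ j, (z j - zbar) ⬝ᵥ (z j - zbar)) / (2 * σ^2)) *
        Real.exp (-(1/2) * ((zbar - μ) ⬝ᵥ (S⁻¹ *ᵥ (zbar - μ))))) *
      Real.exp (-(1/2) * ((y - (μ + R *ᵥ (S⁻¹ *ᵥ (zbar - μ)))) ⬝ᵥ
        ((R⁻¹ + a • 1) *ᵥ (y - (μ + R *ᵥ (S⁻¹ *ᵥ (zbar - μ))))))) := by
    have hsq := hR.completing_square ha0 (y - μ) (zbar - μ)
    have hsum := sum_dotProduct_sub_self z (m := zbar) (by simpa using hz) y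
    rw [sub_sub_sub_cancel_right, sub_sub, ← hS] at hsq
    rw [Fintype.card_fin] at hsum
    rw [ENNReal.toReal_ofReal (by positivity), smul_eq_mul, ← Real.exp_sum, mul_assoc, mul_assoc,
      mul_assoc, ← Real.exp_add, ← Real.exp_add, ← Real.exp_add, ← Finset.sum_div,
      Finset.sum_neg_distrib, hsum]
    congr 2
    have e : ∀ x w : ℝ, -(n * x + w) / (2 * σ^2) = -(1/2) * (a * x) + -w / (2 * σ^2) := by
      intro x w
      rw [ha]
      field_simp
      ring
    rw [e]
    linear_combination -(1/2) * hsq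
  rw [hP, integral_withDensity_eq_integral_toReal_smul hdens (by simp)]
  simp_rw [hint]
  rw [integral_const_mul, hA.integral_exp_neg_half_dotProduct_mulVec, Fintype.card_fin]
  have hconst : C * (√(2 * Real.pi) ^ k * (√(R⁻¹ + a • 1).det)⁻¹) =
      (1 + a • R).det ^ (-(1/2 : ℝ)) := by
    rw [hdet, hC, Real.rpow_natCast, Real.rpow_neg (by positivity),
      Real.rpow_neg (mul_nonneg hRdet.le hA.det_pos.le), ← Real.sqrt_eq_rpow, ← Real.sqrt_eq_rpow,
      Real.sqrt_mul (by positivity), Real.sqrt_mul hRdet.le,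
      Real.sqrt_eq_rpow ((2 * Real.pi) ^ k), ← Real.rpow_natCast_mul (by positivity),
      mul_comm (k : ℝ), Real.rpow_mul_natCast (by positivity), ← Real.sqrt_eq_rpow]
    have := Real.sqrt_pos.mpr hRdet
    have := Real.sqrt_pos.mpr hA.det_pos
    field_simp
  rw [← hconst]
  ring
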